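/- For each fixed (u,x,t) with 0 < u < t, the set function B ↦ P̄(u,x;t,B) is a measure on (X,𝔅(X)) with total mass P̄(u,x;t,X) ≤ 1. -/

import Mathlib

open MeasureTheory Set Real Filter

/-- Feller's iterates `P̄⁽ⁿ⁾(u,x;t,B)` built from a conservative Q-function,
encoded by the jump-rate `qr x t = q(x,t) = -q(x,t,{x})` and the jump kernel
`m x t = q(x,t, · \ {x})`. -/
noncomputable def Pit {X : Type*} [MeasurableSpace X]
    (qr : X → ℝ → ℝ) (m : X → ℝ → Measure X) :
    ℕ → ℝ → X → ℝ → Set X → ℝ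
  | 0 => fun u x t B => B.indicator (fun _ => Real.exp (-∫ s in u..t, qr x s)) x
  | n + 1 => fun u x t B => ∫ s in u..t,
      Real.exp (-∫ θ in u..s, qr x θ) * ∫ y, Pit qr m n s y t B ∂(m x s)

/-- `P̄(u,x;t,B) = Σ_{n≥0} P̄⁽ⁿ⁾(u,x;t,B)`. -/
noncomputable def Pbar {X : Type*} [MeasurableSpace X]
    (qr : X → ℝ → ℝ) (m : X → ℝ → Measure X)
    (u : ℝ) (x : X) (t : ℝ) (B : Set X) : ℝ :=
  ∑' n, Pit qr m n u x t B

open scoped ENNReal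

/-- ENNReal-valued version of the iterates. -/
noncomputable def Kit {X : Type*} [MeasurableSpace X]
    (qr : X → ℝ → ℝ) (m : X → ℝ → Measure X) (t : ℝ) (B : Set X) :
    ℕ → ℝ → X → ℝ≥0∞
  | 0 => fun u x => B.indicator (fun _ => ENNReal.ofReal (Real.exp (-∫ s in u..t, qr x s))) x
  | n + 1 => fun u x => ∫⁻ s in Set.Ioc u t,
      ENNReal.ofReal (Real.exp (-∫ θ in u..s, qr x θ)) * ∫⁻ y, Kit qr m t B n s y ∂(m x s)

theorem exp_lip (a b : ℝ) (ha : 0 ≤ a) (hab : a ≤ b) :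
    |Real.exp (-a) - Real.exp (-b)| ≤ b - a := by
  have h1 : Real.exp (-b) ≤ Real.exp (-a) := Real.exp_le_exp.2 (by linarith)
  rw [abs_of_nonneg (by linarith)]
  have h2 : Real.exp (-b) = Real.exp (-a) * Real.exp (-(b - a)) := by
    rw [← Real.exp_add]; ring_nf
  have h3 : Real.exp (-a) ≤ 1 := Real.exp_le_one_iff.2 (by linarith)
  have h4 := Real.add_one_le_exp (-(b - a))
  have h5 := Real.exp_pos (-a)
  have h6 : Real.exp (-(b-a)) ≤ 1 := Real.exp_le_one_iff.2 (by linarith)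
  rw [h2]
  nlinarith

theorem ftc_exp (f : ℝ → ℝ) (hf : Measurable f) (hf0 : ∀ s, 0 ≤ f s) (C u t : ℝ) (hut : u ≤ t)
    (hC : ∀ s ∈ Icc u t, f s ≤ C) :
    ENNReal.ofReal (Real.exp (-∫ θ in u..t, f θ)) +
      ∫⁻ s in Ioc u t, ENNReal.ofReal (Real.exp (-∫ θ in u..s, f θ)) * ENNReal.ofReal (f s) = 1 := by
  have hC0 : 0 ≤ C := (hf0 u).trans (hC u ⟨le_rfl, hut⟩)
  have hint : IntegrableOn f (Icc u t) := by
    refine Measure.integrableOn_of_bounded (M := C) (by simp) hf.aestronglyMeasurable ?_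
    filter_upwards [ae_restrict_mem measurableSet_Icc] with s hs
    rw [Real.norm_eq_abs, abs_of_nonneg (hf0 s)]
    exact hC s hs
  have hii : ∀ a ∈ Icc u t, ∀ b ∈ Icc u t, IntervalIntegrable f volume a b := by
    intro a ha b hb
    rw [intervalIntegrable_iff]
    exact hint.mono_set (uIoc_subset_uIcc.trans (by
      rw [← uIcc_of_le hut] at *
      exact uIcc_subset_uIcc ha hb))
  have hu : u ∈ Icc u t := ⟨le_rfl, hut⟩
  have ht : t ∈ Icc u t := ⟨hut, le_rfl⟩
  set A : ℝ → ℝ := fun s => ∫ θ in u..s, f θ with hA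
  have hA0 : ∀ s, u ≤ s → 0 ≤ A s := fun s hs =>
    intervalIntegral.integral_nonneg hs (fun x _ => hf0 x)
  have hAs : ∀ a ∈ Icc u t, ∀ b ∈ Icc u t, a ≤ b → 0 ≤ A b - A a ∧ A b - A a ≤ C * (b - a) := by
    intro a ha b hb hab
    have : A b - A a = ∫ θ in a..b, f θ :=
      intervalIntegral.integral_interval_sub_left (hii u hu b hb) (hii u hu a ha)
    rw [this]
    refine ⟨intervalIntegral.integral_nonneg hab (fun x _ => hf0 x), ?_⟩
    calc ∫ θ in a..b, f θ ≤ ∫ θ in a..b, C :=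
          intervalIntegral.integral_mono_on hab (hii a ha b hb) (by simp)
            (fun x hx => hC x ⟨ha.1.trans hx.1, hx.2.trans hb.2⟩)
      _ = C * (b - a) := by simp [mul_comm]
  set g : ℝ → ℝ := fun s => Real.exp (-A s) with hg
  have key : ∀ a ∈ Icc u t, ∀ b ∈ Icc u t, a ≤ b → |g a - g b| ≤ C * (b - a) := by
    intro a ha b hb hab
    have h := hAs a ha b hb hab
    exact (exp_lip (A a) (A b) (hA0 a ha.1) (by linarith)).trans h.2
  have hlip : LipschitzOnWith C.toNNReal g (uIcc u t) := by
    refine LipschitzOnWith.of_dist_le_mul fun a ha b hb => ?_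
    rw [uIcc_of_le hut] at ha hb
    rw [Real.dist_eq, Real.dist_eq, Real.coe_toNNReal _ hC0]
    rcases le_total a b with h | h
    · rw [abs_sub_comm a b, abs_of_nonneg (sub_nonneg.2 h)]; exact key a ha b hb h
    · rw [abs_of_nonneg (sub_nonneg.2 h), abs_sub_comm]; exact key b hb a ha h
  have hder := hlip.absolutelyContinuousOnInterval.integral_deriv_eq_sub
  have hid := hlip.absolutelyContinuousOnInterval.intervalIntegrable_deriv
  have hae : ∀ᵐ s, s ∈ uIoc u t → deriv g s = - (g s * f s) := by
    filter_upwards [(hii u hu t ht).ae_hasDerivAt_integral] with s hs hs'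
    have h := hs (uIoc_subset_uIcc hs') u (by simp)
    have h2 : HasDerivAt g (Real.exp (-A s) * (-f s)) s := h.neg.exp
    rw [h2.deriv]; simp [hg]
  have hae' : ∀ᵐ s ∂(volume.restrict (Ioc u t)), deriv g s = - (g s * f s) := by
    rw [← uIoc_of_le hut]
    exact (ae_restrict_iff' measurableSet_uIoc).2 hae
  have hgi : Integrable (fun s => g s * f s) (volume.restrict (Ioc u t)) := by
    have := ((intervalIntegrable_iff_integrableOn_Ioc_of_le hut).1 hid).neg
    refine this.congr ?_
    filter_upwards [hae'] with s hs
    simp [hs]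
  have hval : ∫ s in Ioc u t, g s * f s = 1 - g t := by
    rw [intervalIntegral.integral_congr_ae hae, intervalIntegral.integral_neg,
      intervalIntegral.integral_of_le hut] at hder
    have : g u = 1 := by simp [hg, hA]
    linarith
  have hg1 : g t ≤ 1 := Real.exp_le_one_iff.2 (by linarith [hA0 t hut])
  have hfin : ∫⁻ s in Ioc u t, ENNReal.ofReal (g s) * ENNReal.ofReal (f s)
      = ENNReal.ofReal (1 - g t) := by
    rw [← hval, ofReal_integral_eq_lintegral_ofReal hgi
      (ae_of_all _ fun s => mul_nonneg (Real.exp_pos _).le (hf0 s))]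
    refine lintegral_congr fun s => ?_
    rw [ENNReal.ofReal_mul (Real.exp_pos _).le]
  change ENNReal.ofReal (g t) + _ = 1
  rw [hfin, ← ENNReal.ofReal_add (Real.exp_pos _).le (by linarith)]
  simp [hg]

section
variable {X : Type*} [MeasurableSpace X] {qr : X → ℝ → ℝ} {m : X → ℝ → Measure X}

theorem meas_A (hqmeas : Measurable (fun p : X × ℝ => qr p.1 p.2)) :
    Measurable (fun p : (ℝ × X) × ℝ =>
      ENNReal.ofReal (Real.exp (-∫ θ in p.1.1..p.2, qr p.1.2 θ))) := by
  refine ENNReal.measurable_ofReal.comp (Real.measurable_exp.comp (Measurable.neg ?_))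
  have aux : ∀ a b : (ℝ × X) × ℝ → ℝ, Measurable a → Measurable b →
      Measurable (fun p : (ℝ × X) × ℝ => ∫ θ in Ioc (a p) (b p), qr p.1.2 θ) := by
    intro a b ha hb
    have : StronglyMeasurable (fun z : ((ℝ × X) × ℝ) × ℝ =>
        {z : ((ℝ × X) × ℝ) × ℝ | a z.1 < z.2 ∧ z.2 ≤ b z.1}.indicator
          (fun z => qr z.1.1.2 z.2) z) := by
      refine Measurable.stronglyMeasurable (Measurable.indicator ?_ ?_)
      · exact hqmeas.comp (f := fun z : ((ℝ × X) × ℝ) × ℝ => (z.1.1.2, z.2)) (by fun_prop)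
      · exact (measurableSet_lt (ha.comp measurable_fst) measurable_snd).inter
          (measurableSet_le measurable_snd (hb.comp measurable_fst))
    convert (this.integral_prod_right' (ν := volume)).measurable using 1
    funext p
    rw [← integral_indicator measurableSet_Ioc]
    rfl
  exact (aux (fun p => p.1.1) (fun p => p.2) (by fun_prop) (by fun_prop)).sub
    (aux (fun p => p.2) (fun p => p.1.1) (by fun_prop) (by fun_prop))

theorem meas_inner
    (hcons : ∀ x t, m x t Set.univ = ENNReal.ofReal (qr x t))
    (hqmeas : Measurable (fun p : X × ℝ => qr p.1 p.2))
    (hkmeas : ∀ B : Set X, MeasurableSet B →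
      Measurable (fun p : X × ℝ => (m p.1 p.2 B).toReal))
    (f : ℝ → X → ℝ≥0∞) (hf : Measurable (fun p : ℝ × X => f p.1 p.2)) :
    Measurable (fun p : X × ℝ => ∫⁻ y, f p.2 y ∂(m p.1 p.2)) := by
  have hfin : ∀ x t, IsFiniteMeasure (m x t) := fun x t => ⟨by rw [hcons]; simp⟩
  let κ : ProbabilityTheory.Kernel (X × ℝ) X :=
    { toFun := fun p => m p.1 p.2
      measurable' := by
        refine Measure.measurable_of_measurable_coe _ fun B hB => ?_
        convert (hkmeas B hB).ennreal_ofReal using 1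
        funext p
        exact (ENNReal.ofReal_toReal (measure_ne_top _ _)).symm }
  have hfl : Measurable (fun p : X × ℝ => ⌊qr p.1 p.2⌋₊) := Nat.measurable_floor.comp hqmeas
  have hS : ∀ n : ℕ, MeasurableSet {p : X × ℝ | ⌊qr p.1 p.2⌋₊ = n} := fun n =>
    hfl (measurableSet_singleton n)
  classical
  have : ProbabilityTheory.IsSFiniteKernel κ := by
    refine ⟨⟨fun n => ProbabilityTheory.Kernel.piecewise (hS n) κ 0, fun n => ?_, ?_⟩⟩
    · refine ⟨⟨ENNReal.ofReal (n + 1), by simp, fun p => ?_⟩⟩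
      rw [ProbabilityTheory.Kernel.piecewise_apply']
      split_ifs with h
      · change m p.1 p.2 univ ≤ _
        rw [hcons]
        apply ENNReal.ofReal_le_ofReal
        have : ⌊qr p.1 p.2⌋₊ = n := h
        rw [← this]
        exact (Nat.lt_floor_add_one _).le
      · simp
    · ext p s hs
      rw [ProbabilityTheory.Kernel.sum_apply' _ _ hs, tsum_eq_single ⌊qr p.1 p.2⌋₊]
      · rw [ProbabilityTheory.Kernel.piecewise_apply', if_pos (Set.mem_ofPred_eq ▸ rfl)]
      · intro b hb
        rw [ProbabilityTheory.Kernel.piecewise_apply', if_neg (by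
          rw [Set.mem_ofPred_eq]; exact hb.symm)]
        simp
  exact Measurable.lintegral_kernel_prod_right' (κ := κ)
    (f := fun z : (X × ℝ) × X => f z.1.2 z.2)
    (hf.comp (f := fun z : (X × ℝ) × X => (z.1.2, z.2)) (by fun_prop))

theorem meas_integrand
    (hcons : ∀ x t, m x t Set.univ = ENNReal.ofReal (qr x t))
    (hqmeas : Measurable (fun p : X × ℝ => qr p.1 p.2))
    (hkmeas : ∀ B : Set X, MeasurableSet B →
      Measurable (fun p : X × ℝ => (m p.1 p.2 B).toReal))
    (f : ℝ → X → ℝ≥0∞) (hf : Measurable (fun p : ℝ × X => f p.1 p.2)) :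
    Measurable (fun p : (ℝ × X) × ℝ =>
      ENNReal.ofReal (Real.exp (-∫ θ in p.1.1..p.2, qr p.1.2 θ)) *
        ∫⁻ y, f p.2 y ∂(m p.1.2 p.2)) :=
  (meas_A hqmeas).mul ((meas_inner hcons hqmeas hkmeas f hf).comp
    (f := fun p : (ℝ × X) × ℝ => (p.1.2, p.2)) (by fun_prop))

theorem meas_K
    (hcons : ∀ x t, m x t Set.univ = ENNReal.ofReal (qr x t))
    (hqmeas : Measurable (fun p : X × ℝ => qr p.1 p.2))
    (hkmeas : ∀ B : Set X, MeasurableSet B →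
      Measurable (fun p : X × ℝ => (m p.1 p.2 B).toReal))
    (t : ℝ) (B : Set X) (hB : MeasurableSet B) (n : ℕ) :
    Measurable (fun p : ℝ × X => Kit qr m t B n p.1 p.2) := by
  induction n with
  | zero =>
    have h := (meas_A hqmeas).comp (f := fun p : ℝ × X => (p, t)) (by fun_prop)
    exact h.indicator (measurable_snd hB)
  | succ n ih =>
    have h := meas_integrand hcons hqmeas hkmeas _ ih
    have h2 : Measurable (fun z : (ℝ × X) × ℝ =>
        {z : (ℝ × X) × ℝ | z.1.1 < z.2 ∧ z.2 ≤ t}.indicator (fun p : (ℝ × X) × ℝ =>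
      ENNReal.ofReal (Real.exp (-∫ θ in p.1.1..p.2, qr p.1.2 θ)) *
        ∫⁻ y, Kit qr m t B n p.2 y ∂(m p.1.2 p.2)) z) :=
      h.indicator ((measurableSet_lt (measurable_fst.comp measurable_fst) measurable_snd).inter
          (measurableSet_le measurable_snd measurable_const))
    convert h2.lintegral_prod_right' (ν := volume) using 1
    funext p
    simp only [Kit]
    rw [← lintegral_indicator measurableSet_Ioc]
    rfl

theorem K_iUnion
    (hcons : ∀ x t, m x t Set.univ = ENNReal.ofReal (qr x t))
    (hqmeas : Measurable (fun p : X × ℝ => qr p.1 p.2))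
    (hkmeas : ∀ B : Set X, MeasurableSet B →
      Measurable (fun p : X × ℝ => (m p.1 p.2 B).toReal))
    (t : ℝ) (B : ℕ → Set X) (hB : ∀ i, MeasurableSet (B i))
    (hd : Pairwise (Function.onFun Disjoint B)) (n : ℕ) : ∀ u x,
    Kit qr m t (⋃ i, B i) n u x = ∑' i, Kit qr m t (B i) n u x := by
  induction n with
  | zero =>
    intro u x
    simp only [Kit]
    by_cases hx : x ∈ ⋃ i, B i
    · obtain ⟨i, hi⟩ := Set.mem_iUnion.1 hx
      rw [Set.indicator_of_mem hx, tsum_eq_single i, Set.indicator_of_mem hi]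
      intro j hj
      exact Set.indicator_of_notMem (fun hxj => Set.disjoint_left.1 (hd hj) hxj hi) _
    · rw [Set.indicator_of_notMem hx]
      symm
      refine ENNReal.tsum_eq_zero.2 fun i => ?_
      exact Set.indicator_of_notMem (fun hxi => hx (Set.mem_iUnion.2 ⟨i, hxi⟩)) _
  | succ n ih =>
    intro u x
    simp only [Kit]
    have hK := fun i => meas_K hcons hqmeas hkmeas t (B i) (hB i) n
    rw [← lintegral_tsum]
    · refine lintegral_congr fun s => ?_
      rw [ENNReal.tsum_mul_left, ← lintegral_tsum]
      · simp_rw [ih]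
      · intro i
        exact ((hK i).comp (f := fun y : X => (s, y)) (by fun_prop)).aemeasurable
    · intro i
      exact ((meas_integrand hcons hqmeas hkmeas _ (hK i)).comp
        (f := fun s : ℝ => ((u, x), s)) (by fun_prop)).aemeasurable

theorem K_sum_le
    (hq0 : ∀ x t, 0 ≤ qr x t)
    (hcons : ∀ x t, m x t Set.univ = ENNReal.ofReal (qr x t))
    (hstable : ∀ x, ∃ C, ∀ t, 0 < t → qr x t ≤ C)
    (hqmeas : Measurable (fun p : X × ℝ => qr p.1 p.2))
    (hkmeas : ∀ B : Set X, MeasurableSet B →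
      Measurable (fun p : X × ℝ => (m p.1 p.2 B).toReal))
    (t : ℝ) (B : Set X) (hB : MeasurableSet B) (n : ℕ) : ∀ u x, 0 < u → u ≤ t →
    ∑ k ∈ Finset.range n, Kit qr m t B k u x ≤ 1 := by
  induction n with
  | zero => intros; simp
  | succ n ih =>
    intro u x hu hut
    obtain ⟨C, hC⟩ := hstable x
    have hK := fun i => meas_K hcons hqmeas hkmeas t B hB i
    rw [Finset.sum_range_succ', add_comm,
      ← ftc_exp (qr x) (hqmeas.comp (f := fun s : ℝ => (x, s)) (by fun_prop)) (hq0 x) C u t hut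
        (fun s hs => hC s (hu.trans_le hs.1))]
    refine add_le_add ?_ ?_
    · simp only [Kit]
      exact Set.indicator_le_self' (fun _ _ => zero_le) x
    · simp only [Kit]
      rw [← lintegral_finsetSum]
      · refine setLIntegral_mono' measurableSet_Ioc fun s hs => ?_
        rw [← Finset.mul_sum, ← lintegral_finsetSum]
        · gcongr
          calc ∫⁻ y, ∑ k ∈ Finset.range n, Kit qr m t B k s y ∂(m x s)
              ≤ ∫⁻ y, 1 ∂(m x s) := lintegral_mono fun y => ih s y (hu.trans hs.1) hs.2
            _ = ENNReal.ofReal (qr x s) := by rw [lintegral_one, hcons]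
        · intro i _
          exact (hK i).comp (f := fun y : X => (s, y)) (by fun_prop)
      · intro i _
        exact (meas_integrand hcons hqmeas hkmeas _ (hK i)).comp
          (f := fun s : ℝ => ((u, x), s)) (by fun_prop)

theorem Pit_eq
    (hq0 : ∀ x t, 0 ≤ qr x t)
    (hcons : ∀ x t, m x t Set.univ = ENNReal.ofReal (qr x t))
    (hstable : ∀ x, ∃ C, ∀ t, 0 < t → qr x t ≤ C)
    (hqmeas : Measurable (fun p : X × ℝ => qr p.1 p.2))
    (hkmeas : ∀ B : Set X, MeasurableSet B →
      Measurable (fun p : X × ℝ => (m p.1 p.2 B).toReal))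
    (t : ℝ) (B : Set X) (hB : MeasurableSet B) (n : ℕ) : ∀ u x, 0 < u → u ≤ t →
    Pit qr m n u x t B = (Kit qr m t B n u x).toReal := by
  have hle : ∀ n u x, 0 < u → u ≤ t → Kit qr m t B n u x ≤ 1 := fun n u x hu hut =>
    le_trans (Finset.single_le_sum (f := fun k => Kit qr m t B k u x) (fun _ _ => zero_le)
      (Finset.self_mem_range_succ n))
      (K_sum_le hq0 hcons hstable hqmeas hkmeas t B hB (n + 1) u x hu hut)
  induction n with
  | zero =>
    intro u x _ _
    by_cases hx : x ∈ B <;> simp [Pit, Kit, hx, Real.exp_nonneg]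
  | succ n ih =>
    intro u x hu hut
    have hK := meas_K hcons hqmeas hkmeas t B hB n
    simp only [Pit, Kit]
    rw [intervalIntegral.integral_of_le hut, ← integral_toReal]
    · refine setIntegral_congr_fun measurableSet_Ioc fun s hs => ?_
      have hs0 : 0 < s := hu.trans hs.1
      simp only [ENNReal.toReal_mul, ENNReal.toReal_ofReal (Real.exp_nonneg _)]
      congr 1
      rw [← integral_toReal]
      · exact integral_congr_ae (ae_of_all _ fun y => ih s y hs0 hs.2)
      · exact (hK.comp (f := fun y : X => (s, y)) (by fun_prop)).aemeasurable
      · exact ae_of_all _ fun y => (hle n s y hs0 hs.2).trans_lt ENNReal.one_lt_top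
    · exact ((meas_integrand hcons hqmeas hkmeas _ hK).comp
        (f := fun s : ℝ => ((u, x), s)) (by fun_prop)).aemeasurable
    · filter_upwards [ae_restrict_mem measurableSet_Ioc] with s hs
      refine ENNReal.mul_lt_top ENNReal.ofReal_lt_top ?_
      calc ∫⁻ y, Kit qr m t B n s y ∂(m x s)
          ≤ ∫⁻ y, 1 ∂(m x s) := lintegral_mono fun y => hle n s y (hu.trans hs.1) hs.2
        _ = ENNReal.ofReal (qr x s) := by rw [lintegral_one, hcons]
        _ < ∞ := ENNReal.ofReal_lt_top

theorem K_empty (t : ℝ) (n : ℕ) : ∀ u x, Kit qr m t ∅ n u x = 0 := by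
  induction n with
  | zero => intro u x; simp [Kit]
  | succ n ih => intro u x; simp [Kit, ih]

end

/-- For fixed `0 < u < t` and `x`, `B ↦ P̄(u,x;t,B)` is a measure on `(X, 𝔅(X))` with
total mass at most `1`. -/
theorem stmt15 {X : Type*} [MeasurableSpace X]
    (qr : X → ℝ → ℝ) (m : X → ℝ → Measure X)
    (hq0 : ∀ x t, 0 ≤ qr x t)
    (hdiag : ∀ x t, m x t {x} = 0)
    (hcons : ∀ x t, m x t Set.univ = ENNReal.ofReal (qr x t))
    (hstable : ∀ x, ∃ C, ∀ t, 0 < t → qr x t ≤ C)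
    (hqmeas : Measurable (fun p : X × ℝ => qr p.1 p.2))
    (hkmeas : ∀ B : Set X, MeasurableSet B →
      Measurable (fun p : X × ℝ => (m p.1 p.2 B).toReal))
    (u : ℝ) (x : X) (t : ℝ) (hu : 0 < u) (hut : u < t) :
    ∃ μ : Measure X,
      (∀ B : Set X, MeasurableSet B → (μ B).toReal = Pbar qr m u x t B) ∧
      μ Set.univ ≤ 1 := by
  have hsum := fun B hB n => K_sum_le hq0 hcons hstable hqmeas hkmeas t B hB n u x hu hut.le
  have htsum : ∀ B : Set X, MeasurableSet B → ∑' n, Kit qr m t B n u x ≤ 1 := fun B hB =>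
    ENNReal.tsum_le_of_sum_range_le fun n => hsum B hB n
  refine ⟨Measure.ofMeasurable (fun B _ => ∑' n, Kit qr m t B n u x) (by simp [K_empty]) ?_,
    ?_, ?_⟩
  · intro B hB hd
    rw [ENNReal.tsum_comm]
    exact tsum_congr fun n => K_iUnion hcons hqmeas hkmeas t B hB hd n u x
  · intro B hB
    rw [Measure.ofMeasurable_apply _ hB, Pbar, ENNReal.tsum_toReal_eq]
    · exact tsum_congr fun n =>
        (Pit_eq hq0 hcons hstable hqmeas hkmeas t B hB n u x hu hut.le).symm
    · exact fun n => ((ENNReal.le_tsum n).trans (htsum B hB)).trans_lt ENNReal.one_lt_top |>.ne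
  · rw [Measure.ofMeasurable_apply _ MeasurableSet.univ]
    exact htsum _ MeasurableSet.univ
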